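/- Let k, l, m ∈ ℕ, let α : {0,1,…,k} → {0,1,…,m} and β : {0,1,…,l} → {0,1,…,m} be nondecreasing maps with α(0) = 0 and β(0) = 0, write ê_1, …, ê_m for the standard basis of ℤ^m and set ê_0 := 0. Let p₀ = (0,0), p₁, …, p_{k+l} = (k,l) be a monotone lattice path in {0,…,k} × {0,…,l}, and let n_{ij} be nonnegative integers indexed by the points (i,j) of the path other than (0,0). Then Σ_{(i,j)} n_{ij} · ê_{α(i)} = Σ_{(i,j)} n_{ij} · ê_{β(j)} in ℤ^m if and only if n_{ij} = 0 for every path point (i,j) with α(i) ≠ β(j). -/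

import Mathlib

open scoped BigOperators

/-- `stdE m i : ℤ^m` is the `i`-th standard basis vector `ê_i` for `1 ≤ i ≤ m`
(at position `i - 1`), with the convention `ê_0 = 0`. -/
def stdE (m i : ℕ) : Fin m → ℤ := fun p => if (p : ℕ) + 1 = i then 1 else 0

/-- `p` is a monotone lattice path from `(0,0)` to `(k,l)` in `{0,…,k} × {0,…,l}`:
each step increases exactly one coordinate by `1`. -/
def IsLatticePath (k l : ℕ) (p : Fin (k + l + 1) → ℕ × ℕ) : Prop :=
  p 0 = (0, 0) ∧ p (Fin.last (k + l)) = (k, l) ∧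
  (∀ t, (p t).1 ≤ k ∧ (p t).2 ≤ l) ∧
  ∀ t : Fin (k + l), p t.succ = ((p t.castSucc).1 + 1, (p t.castSucc).2) ∨
    p t.succ = ((p t.castSucc).1, (p t.castSucc).2 + 1)

/-- Summing the coordinates of `ê_i` from position `v ≥ 1` on tests whether `v ≤ i`. -/
theorem sum_stdE_ge {m v i : ℕ} (hv : 1 ≤ v) (hi : i ≤ m) :
    (∑ q : Fin m, if v ≤ (q : ℕ) + 1 then stdE m i q else 0) = if v ≤ i then 1 else 0 := by
  split_ifs with h
  · rw [Finset.sum_eq_single (⟨i - 1, by omega⟩ : Fin m)]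
    · simp only [stdE]
      grind
    · intro q _ hq
      have : (q : ℕ) ≠ i - 1 := fun e => hq (Fin.ext e)
      simp only [stdE]
      grind
    · simp
  · refine Finset.sum_eq_zero fun q _ => ?_
    simp only [stdE]
    grind

theorem sum_ite_le_eq_of_sum_smul_stdE_eq {ι : Type*} [Fintype ι] {m v : ℕ} {a b n : ι → ℕ}
    (hv : 1 ≤ v) (ham : ∀ t, a t ≤ m) (hbm : ∀ t, b t ≤ m)
    (h : ∑ t, (n t : ℤ) • stdE m (a t) = ∑ t, (n t : ℤ) • stdE m (b t)) :
    (∑ t, if v ≤ a t then n t else 0) = ∑ t, if v ≤ b t then n t else 0 := by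
  have key : ∀ c : ι → ℕ, (∀ t, c t ≤ m) →
      (∑ q : Fin m, if v ≤ (q : ℕ) + 1 then (∑ t, (n t : ℤ) • stdE m (c t)) q else 0) =
        ((∑ t, if v ≤ c t then n t else 0 : ℕ) : ℤ) := by
    intro c hc
    calc _ = ∑ q : Fin m, ∑ t, (n t : ℤ) *
          (if v ≤ (q : ℕ) + 1 then stdE m (c t) q else 0) := by
          refine Finset.sum_congr rfl fun q _ => ?_
          split_ifs <;> simp
      _ = ∑ t, (n t : ℤ) * (if v ≤ c t then 1 else 0) := by
          rw [Finset.sum_comm]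
          refine Finset.sum_congr rfl fun t _ => ?_
          rw [← Finset.mul_sum, sum_stdE_ge hv (hc t)]
      _ = _ := by simp
  exact_mod_cast (key a ham).symm.trans ((by rw [h] : _ = _).trans (key b hbm))

/-- If two nondecreasing sequences of indices give the same weighted sum of basis vectors, the
weight vanishes wherever the first index is smaller than the second. -/
theorem weight_eq_zero_of_lt {ι : Type*} [Fintype ι] [LinearOrder ι] {m : ℕ} {a b n : ι → ℕ}
    (ha : Monotone a) (hb : Monotone b) (ham : ∀ t, a t ≤ m) (hbm : ∀ t, b t ≤ m)
    (h : ∑ t, (n t : ℤ) • stdE m (a t) = ∑ t, (n t : ℤ) • stdE m (b t))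
    {t : ι} (ht : a t < b t) : n t = 0 := by
  have hsum := sum_ite_le_eq_of_sum_smul_stdE_eq (v := b t) (by omega) ham hbm h
  have hle : ∀ s ∈ Finset.univ,
      (if b t ≤ a s then n s else 0) ≤ if b t ≤ b s then n s else 0 := by
    intro s _
    by_cases hs : b t ≤ a s
    · have hts : t ≤ s := le_of_not_ge fun hst => absurd (ha hst) (by omega)
      simp [hs, hb hts]
    · simp [hs]
  have := (Finset.sum_eq_sum_iff_of_le hle).1 hsum t (Finset.mem_univ t)
  simpa [not_le.2 ht, eq_comm] using this

theorem IsLatticePath.monotone {k l : ℕ} {p : Fin (k + l + 1) → ℕ × ℕ}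
    (hp : IsLatticePath k l p) : Monotone p := by
  refine Fin.monotone_iff_le_succ.2 fun t => ?_
  rcases hp.2.2.2 t with h | h <;> rw [h] <;> constructor <;> simp

/-- For nondecreasing maps `α : {0,…,k} → {0,…,m}`, `β : {0,…,l} → {0,…,m}` with
`α 0 = β 0 = 0`, a monotone lattice path `p` from `(0,0)` to `(k,l)`, and nonnegative
integers `n_t` indexed by the points `p_t` (`t = 1, …, k+l`) of the path (which are the
points other than `(0,0)`), one has
`Σ_t n_t ê_{α(i_t)} = Σ_t n_t ê_{β(j_t)}` in `ℤ^m` if and only if `n_t = 0` whenever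
`α(i_t) ≠ β(j_t)`. -/
theorem stmt9 (k l m : ℕ) (α β : ℕ → ℕ)
    (hα0 : α 0 = 0) (hβ0 : β 0 = 0)
    (hαmono : ∀ i i', i ≤ i' → i' ≤ k → α i ≤ α i')
    (hβmono : ∀ j j', j ≤ j' → j' ≤ l → β j ≤ β j')
    (hαm : ∀ i, i ≤ k → α i ≤ m) (hβm : ∀ j, j ≤ l → β j ≤ m)
    (p : Fin (k + l + 1) → ℕ × ℕ) (hp : IsLatticePath k l p)
    (n : Fin (k + l) → ℕ) :
    (∑ t : Fin (k + l), (n t : ℤ) • stdE m (α (p t.succ).1)) =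
      (∑ t : Fin (k + l), (n t : ℤ) • stdE m (β (p t.succ).2)) ↔
    ∀ t : Fin (k + l), α (p t.succ).1 ≠ β (p t.succ).2 → n t = 0 := by
  have hle := hp.2.2.1
  have ha : Monotone fun t : Fin (k + l) => α (p t.succ).1 := fun s t hst =>
    hαmono _ _ (hp.monotone (Fin.succ_le_succ_iff.2 hst)).1 (hle _).1
  have hb : Monotone fun t : Fin (k + l) => β (p t.succ).2 := fun s t hst =>
    hβmono _ _ (hp.monotone (Fin.succ_le_succ_iff.2 hst)).2 (hle _).2
  have ham : ∀ t : Fin (k + l), α (p t.succ).1 ≤ m := fun t => hαm _ (hle _).1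
  have hbm : ∀ t : Fin (k + l), β (p t.succ).2 ≤ m := fun t => hβm _ (hle _).2
  constructor
  · intro h t ht
    rcases lt_or_gt_of_ne ht with hlt | hlt
    · exact weight_eq_zero_of_lt ha hb ham hbm h hlt
    · exact weight_eq_zero_of_lt hb ha hbm ham h.symm hlt
  · intro h
    refine Finset.sum_congr rfl fun t _ => ?_
    by_cases ht : α (p t.succ).1 = β (p t.succ).2
    · rw [ht]
    · simp [h t ht]
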